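/- Let R = k[y_0,…,y_m] and let Q_1,…,Q_r ∈ kᵐ with r ≥ 1, where Q_j = (b_{j,1},…,b_{j,m}), and let I_{Q_j} ⊆ R be the ideal generated by b_{j,i}·y_0 − y_i for 1 ≤ i ≤ m. Then the ideal J′ = (⋂_{j=1}^{r} I_{Q_j}) + ⟨y_0⟩ satisfies ⟨y_0,…,y_m⟩^r ⊆ J′ ⊆ ⟨y_0,…,y_m⟩; consequently the radical of J′ equals the maximal ideal ⟨y_0,…,y_m⟩ and J′ is a primary ideal of R. -/

import Mathlib

open MvPolynomial

noncomputable section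

/-- The polynomial ring `R = k[y_0, …, y_m]`. -/
abbrev PolyR (k : Type*) [Field k] (m : ℕ) : Type _ := MvPolynomial (Fin (m + 1)) k

/-- The vanishing ideal `⟨b_i y_0 - y_i : 1 ≤ i ≤ m⟩ ⊆ R` of the point
`[1 : b_1 : ⋯ : b_m] ∈ ℙᵐ`. -/
def Ib' {k : Type*} [Field k] {m : ℕ} (b : Fin m → k) : Ideal (PolyR k m) :=
  Ideal.span (Set.range fun i : Fin m => C (b i) * X 0 - X i.succ)

/-- The maximal ideal `⟨y_0, …, y_m⟩` of `R`. -/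
def yMax (k : Type*) [Field k] (m : ℕ) : Ideal (PolyR k m) :=
  Ideal.span (Set.range fun i : Fin (m + 1) => (X i : PolyR k m))

theorem aux_prod {R ι : Type*} [CommRing R] (s : Finset ι) (M A : Ideal R) (f : ι → Ideal R)
    (h : ∀ j, M ≤ f j + A) : M ^ s.card ≤ s.prod f + A := by
  classical
  induction s using Finset.induction_on with
  | empty => simp
  | insert a s ha ih =>
    rw [Finset.card_insert_of_notMem ha, Finset.prod_insert ha, pow_succ']
    refine (Ideal.mul_mono (h a) ih).trans ?_
    rw [add_mul, mul_add]
    simp only [Submodule.add_eq_sup]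
    refine sup_le (sup_le le_sup_left ?_) ?_
    · exact Ideal.mul_le.2 fun x _ y hy => Ideal.mem_sup_right (Ideal.mul_mem_left _ x hy)
    · exact Ideal.mul_le.2 fun x hx y _ => Ideal.mem_sup_right (Ideal.mul_mem_right y _ hx)

theorem yMax_max (k : Type*) [Field k] (m : ℕ) : (yMax k m).IsMaximal := by
  have : yMax k m = RingHom.ker (constantCoeff : PolyR k m →+* k) := by
    apply le_antisymm
    · refine Ideal.span_le.2 ?_
      rintro _ ⟨i, rfl⟩
      simp [RingHom.mem_ker]
    · intro p hp
      rw [yMax, ← Set.image_univ, mem_ideal_span_X_image]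
      intro d hd
      by_contra! hc
      have : d = 0 := by
        ext i
        simpa using hc i (Set.mem_univ i)
      subst this
      exact (mem_support_iff.1 hd) hp
  rw [this]
  exact RingHom.ker_isMaximal_of_surjective _ fun x => ⟨C x, by simp⟩

/-- **Key step in Proposition 2.7**: with `J′ = (⋂_{j=1}^{r} I_{Q_j}) + ⟨y_0⟩` one has
`⟨y_0,…,y_m⟩^r ⊆ J′ ⊆ ⟨y_0,…,y_m⟩`; consequently `√J′ = ⟨y_0,…,y_m⟩` and `J′` is a
primary ideal of `R`. -/
theorem stmt7 (k : Type*) [Field k] [IsAlgClosed k] (m : ℕ) (hm : 1 ≤ m)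
    (r : ℕ) (hr : 1 ≤ r) (Q : Fin r → Fin m → k)
    (J' : Ideal (PolyR k m))
    (hJ' : J' = (⨅ j : Fin r, Ib' (Q j)) + Ideal.span {(X 0 : PolyR k m)}) :
    yMax k m ^ r ≤ J' ∧ J' ≤ yMax k m ∧ J'.radical = yMax k m ∧ J'.IsPrimary := by
  have hX : ∀ i, (X i : PolyR k m) ∈ yMax k m := fun i => Ideal.subset_span ⟨i, rfl⟩
  have h1 : yMax k m ^ r ≤ J' := by
    have := aux_prod Finset.univ (yMax k m) (Ideal.span {(X 0 : PolyR k m)})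
      (fun j => Ib' (Q j)) ?_
    · rw [Finset.card_univ, Fintype.card_fin] at this
      rw [hJ']
      refine this.trans (sup_le_sup_right (Ideal.prod_le_inf.trans ?_) _)
      rw [Finset.inf_univ_eq_iInf]
    · intro j
      refine Ideal.span_le.2 ?_
      rintro _ ⟨i, rfl⟩
      have h0 : (X 0 : PolyR k m) ∈ Ib' (Q j) + Ideal.span {(X 0 : PolyR k m)} :=
        Ideal.mem_sup_right (Ideal.mem_span_singleton_self _)
      refine Fin.cases h0 (fun i => ?_) i
      have h2 : C (Q j i) * X 0 - X i.succ ∈ Ib' (Q j) + Ideal.span {(X 0 : PolyR k m)} :=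
        Ideal.mem_sup_left (Ideal.subset_span ⟨i, rfl⟩)
      have h3 := sub_mem (Ideal.mul_mem_left _ (C (Q j i)) h0) h2
      simpa using h3
  have h2 : J' ≤ yMax k m := by
    rw [hJ']
    refine sup_le ((iInf_le _ ⟨0, hr⟩).trans (Ideal.span_le.2 ?_)) (Ideal.span_le.2 ?_)
    · rintro _ ⟨i, rfl⟩
      exact sub_mem (Ideal.mul_mem_left _ _ (hX 0)) (hX _)
    · rintro _ rfl
      exact hX 0
  have hM := yMax_max k m
  have h3 : J'.radical = yMax k m := by
    apply le_antisymm
    · exact hM.isPrime.radical_le_iff.2 h2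
    · intro x hx
      exact ⟨r, h1 (Ideal.pow_mem_pow hx r)⟩
  exact ⟨h1, h2, h3, Ideal.isPrimary_of_isMaximal_radical (h3 ▸ hM)⟩
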